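/- arXiv:2401.13819 — 2 statements merged into one kernel-verified Lean document; each statement's English description precedes it below -/
import Mathlib

section
/- For every integer d ≥ 3, setting a = 1 - p*, b = 1/d and c = e^{p*-1}, the quantity (2 - c/2)·(1 - ab)^d + (5/2 - c)·a^d·(1-b)^d - a^d - 1/2 is strictly positive. -/
noncomputable def g (p : ℝ) (d : ℕ) : ℝ :=
  1 + (1 - (1 - p) / (d : ℝ)) ^ d + ((1 - p) * (1 - 1 / (d : ℝ))) ^ d

noncomputable def pstar : ℝ := (10 - 6 * Real.sqrt 2) / 7

noncomputable def alphaAlg : ℝ := g pstar 3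

noncomputable def zeta (p : ℝ) (d : ℕ) (μA μB μC : ℝ) : ℝ :=
  let T : ℝ := 1 - μA + μA * (1 - (1 - p) / (d : ℝ)) ^ d
  let E : ℝ := 1 - μB + Real.exp (p - 1) * μB
  let Q : ℝ := (1 - p) ^ d * (1 - μA + μA * (1 - 1 / (d : ℝ)) ^ d)
  1 + T / 2 + E * T / 2 + μC * (1 - p) * E * T + (1 - μC * (1 - p)) * E * Q

noncomputable def psi (p : ℝ) (d : ℕ) (μA μB μC : ℝ) : ℝ :=
  zeta p d μA μB μC / (μA + 1.5 * μB + 3 * μC)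

/-- For `x ≤ 1`, the sequence `(1 - x / d) ^ d` is bounded below by its value at `d = 3`
for all `d ≥ 3`. -/
theorem one_sub_div_three_pow_le {x : ℝ} (hx : x ≤ 1) {d : ℕ} (hd : 3 ≤ d) :
    (1 - x / 3) ^ 3 ≤ (1 - x / (d : ℝ)) ^ d := by
  have hd' : (3 : ℝ) ≤ d := by exact_mod_cast hd
  have hd0 : (0 : ℝ) < d := by linarith
  have hxd : x / d ≤ 1 := by
    rw [div_le_one hd0]
    linarith
  have bernoulli : 1 - x / 3 ≤ (1 - x / d) ^ ((d : ℝ) / 3) := by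
    have h := one_add_mul_self_le_rpow_one_add (s := -(x / d)) (by linarith)
      (p := (d : ℝ) / 3) (by linarith)
    have e : 1 + (d : ℝ) / 3 * -(x / d) = 1 - x / 3 := by
      field_simp
      ring
    rwa [e, ← sub_eq_add_neg] at h
  calc (1 - x / 3) ^ 3 ≤ ((1 - x / d) ^ ((d : ℝ) / 3)) ^ 3 :=
        pow_le_pow_left₀ (by linarith) bernoulli 3
    _ = (1 - x / d) ^ d := by
        rw [← Real.rpow_natCast, ← Real.rpow_mul (by linarith), ← Real.rpow_natCast]
        congr 1
        push_cast
        ring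

theorem one_sub_pstar_mem_Icc : 1 - pstar ∈ Set.Icc (0.78 : ℝ) 0.785 := by
  have h1 : (1.414 : ℝ) ≤ √2 := Real.le_sqrt_of_sq_le (by norm_num)
  have h2 : √2 ≤ (1.415 : ℝ) := Real.sqrt_le_iff.mpr (by norm_num)
  constructor <;> unfold pstar <;> linarith

theorem exp_pstar_sub_one_le_half : Real.exp (pstar - 1) ≤ 1 / 2 := by
  have ha := one_sub_pstar_mem_Icc.1
  have h := Real.quadratic_le_exp_of_nonneg (x := 1 - pstar) (by linarith)
  rw [← neg_sub, Real.exp_neg, one_div]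
  exact inv_anti₀ two_pos (by nlinarith)

theorem psi2_at_one_positive (d : ℕ) (hd : 3 ≤ d) :
    0 < (2 - Real.exp (pstar - 1) / 2) * (1 - (1 - pstar) * (1 / (d : ℝ))) ^ d
      + (5 / 2 - Real.exp (pstar - 1)) * (1 - pstar) ^ d * (1 - 1 / (d : ℝ)) ^ d
      - (1 - pstar) ^ d - 1 / 2 := by
  obtain ⟨ha1, ha2⟩ := one_sub_pstar_mem_Icc
  have hc := exp_pstar_sub_one_le_half
  rw [mul_one_div]
  generalize Real.exp (pstar - 1) = c at *
  generalize 1 - pstar = a at *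
  have hT := one_sub_div_three_pow_le (x := a) (by linarith) hd
  have hU := one_sub_div_three_pow_le (le_refl (1 : ℝ)) hd
  have hP : a ^ d ≤ 0.785 ^ 3 :=
    (pow_le_pow_of_le_one (by linarith) (by linarith) hd).trans
      (pow_le_pow_left₀ (by linarith) ha2 3)
  have hP0 : 0 ≤ a ^ d := pow_nonneg (by linarith) d
  have hT' : (1 - 0.785 / 3 : ℝ) ^ 3 ≤ (1 - a / d) ^ d :=
    (pow_le_pow_left₀ (by norm_num) (by linarith) 3).trans hT
  have first : 7 / 4 * (1 - 0.785 / 3 : ℝ) ^ 3 ≤ (2 - c / 2) * (1 - a / d) ^ d :=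
    mul_le_mul (by linarith) hT' (by norm_num) (by linarith)
  have coeff : 2 * (1 - 1 / 3 : ℝ) ^ 3 ≤ (5 / 2 - c) * (1 - 1 / (d : ℝ)) ^ d :=
    mul_le_mul (by linarith) hU (by norm_num) (by linarith)
  have second := mul_le_mul_of_nonneg_left coeff hP0
  norm_num at first second hP
  norm_num
  linarith
end

section
/- For d ∈ {1,2} and every μ ∈ [0,1], one has ψ(p*, d, μ, 1-μ, 0) ≤ α_alg. -/
lemma pstar_mem_Icc : pstar ∈ Set.Icc (0.21637 : ℝ) 0.2164 := by
  have hl : (1.41421 : ℝ) ≤ Real.sqrt 2 := Real.le_sqrt_of_sq_le (by norm_num)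
  have hu : Real.sqrt 2 ≤ 1.41422 := Real.sqrt_le_iff.2 (by norm_num)
  unfold pstar
  constructor <;> linarith

lemma le_alphaAlg : 1.5456 ≤ alphaAlg := by
  obtain ⟨hl, hu⟩ := pstar_mem_Icc
  have h₁ : (1 - (1 - 0.21637) / 3 : ℝ) ^ 3 ≤ (1 - (1 - pstar) / 3) ^ 3 := by
    gcongr
  have h₂ : ((1 - 0.2164) * (1 - 1 / 3) : ℝ) ^ 3 ≤ ((1 - pstar) * (1 - 1 / 3)) ^ 3 := by
    gcongr
  unfold alphaAlg g
  push_cast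
  norm_num at h₁ h₂ ⊢
  linarith

lemma exp_pstar_sub_one_le : Real.exp (pstar - 1) ≤ 0.457 := by
  have hexp : (0.457 : ℝ)⁻¹ ≤ Real.exp 0.7836 := by
    refine le_trans ?_ (Real.sum_le_exp_of_nonneg (by norm_num) 6)
    norm_num [Finset.sum_range_succ, Nat.factorial]
  calc Real.exp (pstar - 1) ≤ Real.exp (-0.7836) :=
        Real.exp_le_exp.2 (by linarith [pstar_mem_Icc.2])
    _ = (Real.exp 0.7836)⁻¹ := Real.exp_neg _
    _ ≤ 0.457 := inv_le_of_inv_le₀ (by norm_num) hexp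

/-- Upper bounds `T'`, `E'`, `Q'` for the three factors of `zeta` bound the numerator of `psi`. -/
lemma numerator_mono {T E Q T' E' Q' : ℝ} (hT₀ : 0 ≤ T) (hQ₀ : 0 ≤ Q) (hE'₀ : 0 ≤ E')
    (hT : T ≤ T') (hE : E ≤ E') (hQ : Q ≤ Q') :
    1 + T / 2 + E * T / 2 + E * Q ≤ 1 + T' / 2 + E' * T' / 2 + E' * Q' := by
  gcongr

theorem psi_le_alphaAlg_d_one_two (d : ℕ) (hd : d = 1 ∨ d = 2) :
    ∀ μ ∈ Set.Icc (0 : ℝ) 1, psi pstar d μ (1 - μ) 0 ≤ alphaAlg := by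
  rintro μ ⟨h₀, h₁⟩
  obtain ⟨hl, hu⟩ := pstar_mem_Icc
  have hν : 0 ≤ 1 - μ := sub_nonneg.2 h₁
  have hE : 1 - (1 - μ) + Real.exp (pstar - 1) * (1 - μ) ≤ μ + 0.457 * (1 - μ) := by
    linarith [mul_le_mul_of_nonneg_right exp_pstar_sub_one_le hν]
  have hE' : 0 ≤ μ + 0.457 * (1 - μ) := by positivity
  unfold psi zeta
  rw [div_le_iff₀ (by linarith)]
  have hα : 1.5456 * (μ + 1.5 * (1 - μ)) ≤ alphaAlg * (μ + 1.5 * (1 - μ) + 3 * 0) := by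
    rw [mul_zero, add_zero]
    gcongr
    exact le_alphaAlg
  refine le_trans ?_ hα
  simp only [zero_mul, sub_zero, add_zero, one_mul]
  rcases hd with rfl | rfl
  · refine (numerator_mono (T' := 1 - μ + μ * 0.2164) (Q' := 0.78363 * (1 - μ))
      ?_ ?_ hE' ?_ hE ?_).trans ?_
    · norm_num
      nlinarith
    · norm_num
      exact mul_nonneg (by linarith) hν
    · norm_num
      nlinarith
    · norm_num
      nlinarith
    · nlinarith [sq_nonneg (μ - 0.389)]
  · have hp : (1 - (1 - pstar) / 2) ^ 2 ≤ 0.36991 := by nlinarith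
    have hq : (1 - pstar) ^ 2 ≤ 0.61408 := by nlinarith
    refine (numerator_mono (T' := 1 - μ + μ * 0.36991) (Q' := 0.61408 * (1 - μ * 0.75))
      ?_ ?_ hE' ?_ hE ?_).trans ?_
    · positivity
    · positivity
    · push_cast
      gcongr
    · push_cast
      gcongr
      linarith
    · nlinarith [sq_nonneg (μ - 0.835)]
end
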